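/- arXiv:2005.10325 — 6 statements merged into one kernel-verified Lean document; each statement's English description precedes it below -/
import Mathlib

section
/- Let ℙ be a preorder and κ an infinite cardinal. Then κ ∈ spec(ℙ) if and only if c(ℱ(𝒜)) > κ for every κ-large family 𝒜 of antichains of ℙ. -/
universe u

/-- Two elements of a preorder are *compatible* if they have a common lower bound. -/
def PCompat {α : Type u} [Preorder α] (p q : α) : Prop := ∃ r, r ≤ p ∧ r ≤ q

/-- An *antichain*: a set of pairwise incompatible elements. -/
def PAntichain {α : Type u} [Preorder α] (A : Set α) : Prop :=
  A.Pairwise fun p q => ¬ PCompat p q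

/-- The *cellularity* of a preorder: the supremum of ℵ₀ and the cardinalities of antichains. -/
noncomputable def cellularity (α : Type u) [Preorder α] : Cardinal.{u} :=
  max Cardinal.aleph0
    (sSup {c : Cardinal.{u} | ∃ A : Set α, PAntichain A ∧ c = Cardinal.mk ↑A})

/-- The *cellular spectrum* of a preorder: the infinite cardinals κ such that the product
with any preorder of cellularity at most κ has cellularity at most κ. -/
def cellSpec (α : Type u) [Preorder α] : Set Cardinal.{u} :=
  {κ | Cardinal.aleph0 ≤ κ ∧
    ∀ (β : Type u) [Preorder β], cellularity β ≤ κ → cellularity (α × β) ≤ κ}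

/-- A *κ-large family*: a family of antichains whose union has cardinality at least κ⁺. -/
def IsLargeFamily {α : Type u} [Preorder α] (κ : Cardinal.{u}) (𝒜 : Set (Set α)) : Prop :=
  (∀ A ∈ 𝒜, PAntichain A) ∧ Order.succ κ ≤ Cardinal.mk ↑(⋃₀ 𝒜)

/-- ℱ(𝒜): the collection of all finite subsets of members of 𝒜. -/
def FinApprox {α : Type u} (𝒜 : Set (Set α)) : Type u :=
  {F : Finset α // ∃ A ∈ 𝒜, ↑F ⊆ A}

/-- ℱ(𝒜) is ordered by reverse inclusion. -/
instance {α : Type u} (𝒜 : Set (Set α)) : Preorder (FinApprox 𝒜) where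
  le P Q := Q.1 ⊆ P.1
  le_refl P := subset_rfl
  le_trans _ _ _ h1 h2 := Finset.Subset.trans h2 h1

theorem cellularity_le_iff' {α : Type u} [Preorder α] (κ : Cardinal.{u})
    (hκ : Cardinal.aleph0 ≤ κ) :
    cellularity α ≤ κ ↔ ∀ A : Set α, PAntichain A → Cardinal.mk ↑A ≤ κ := by
  have hb : BddAbove {c : Cardinal.{u} | ∃ A : Set α, PAntichain A ∧ c = Cardinal.mk ↑A} := by
    refine ⟨Cardinal.mk α, ?_⟩
    rintro c ⟨A, -, rfl⟩
    exact Cardinal.mk_set_le A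
  unfold cellularity
  constructor
  · intro h A hA
    exact (le_csSup hb ⟨A, hA, rfl⟩).trans ((le_max_right _ _).trans h)
  · intro h
    refine max_le hκ (csSup_le' ?_)
    rintro c ⟨A, hA, rfl⟩
    exact h A hA

/-- κ ∈ spec(ℙ) iff c(ℱ(𝒜)) > κ for every κ-large family 𝒜 of antichains of ℙ. -/
theorem mem_cellSpec_iff_finApprox {α : Type u} [Preorder α] (κ : Cardinal.{u})
    (hκ : Cardinal.aleph0 ≤ κ) :
    κ ∈ cellSpec α ↔
      ∀ 𝒜 : Set (Set α), IsLargeFamily κ 𝒜 → κ < cellularity (FinApprox 𝒜) := by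
  constructor
  · rintro ⟨-, h⟩ 𝒜 ⟨h1, h2⟩
    by_contra hc
    have h3 := (cellularity_le_iff' κ hκ).1 (h (FinApprox 𝒜) (not_lt.1 hc))
    have hm : ∀ p : ↑(⋃₀ 𝒜), ∃ A ∈ 𝒜, (↑({p.1} : Finset α) : Set α) ⊆ A := by
      rintro ⟨p, A, hA, hp⟩
      exact ⟨A, hA, by simpa using hp⟩
    let f : ↑(⋃₀ 𝒜) → α × FinApprox 𝒜 := fun p => (p.1, ⟨{p.1}, hm p⟩)
    have hf : Function.Injective f := fun p q hpq => Subtype.ext (congrArg Prod.fst hpq)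
    have h4 : PAntichain (Set.range f) := by
      rintro _ ⟨p, rfl⟩ _ ⟨q, rfl⟩ hne ⟨⟨r, F⟩, hp, hq⟩
      obtain ⟨A, hA, hFA⟩ := F.2
      have hpF : p.1 ∈ F.1 := hp.2 (Finset.mem_singleton_self _)
      have hqF : q.1 ∈ F.1 := hq.2 (Finset.mem_singleton_self _)
      refine h1 A hA (hFA hpF) (hFA hqF) ?_ ⟨r, hp.1, hq.1⟩
      intro he
      exact hne (congrArg f (Subtype.ext he))
    have h5 := h3 _ h4
    rw [Cardinal.mk_range_eq f hf] at h5
    exact absurd (Order.lt_succ κ) (not_lt.2 (h2.trans h5))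
  · intro h
    refine ⟨hκ, fun β _ hβ => ?_⟩
    rw [cellularity_le_iff' κ hκ] at hβ ⊢
    intro X hX
    by_contra hlt
    have hs : ∀ p : α, ∃ q : β, (∃ q', (p, q') ∈ X) → (p, q) ∈ X := by
      intro p
      by_cases hp : ∃ q', (p, q') ∈ X
      · exact ⟨hp.choose, fun _ => hp.choose_spec⟩
      · have : X.Nonempty := by
          by_contra hne
          rw [Set.not_nonempty_iff_eq_empty] at hne
          subst hne
          simp at hlt
        exact ⟨this.choose.2, fun h => absurd h hp⟩
    choose s hs using hs
    let D : Set α := Prod.fst '' X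
    have hD : ∀ p ∈ D, (p, s p) ∈ X := by
      rintro _ ⟨⟨p, q⟩, hx, rfl⟩
      exact hs p ⟨q, hx⟩
    have hDc : Order.succ κ ≤ Cardinal.mk ↑D := by
      rw [Order.succ_le_iff]
      by_contra hDk
      apply hlt
      have hsub : X ⊆ ⋃ p ∈ D, Prod.mk p '' {q | (p, q) ∈ X} := by
        rintro ⟨p, q⟩ hx
        simp only [Set.mem_iUnion]
        exact ⟨p, ⟨_, hx, rfl⟩, q, hx, rfl⟩
      refine (Cardinal.mk_le_mk_of_subset hsub).trans ((Cardinal.mk_biUnion_le _ _).trans ?_)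
      refine (mul_le_mul' (not_lt.1 hDk) (ciSup_le' ?_)).trans (Cardinal.mul_eq_self hκ).le
      intro p
      refine Cardinal.mk_image_le.trans (hβ _ ?_)
      rintro q hq q' hq' hne ⟨r, hr, hr'⟩
      exact hX hq hq' (fun he => hne (congrArg Prod.snd he))
        ⟨(p.1, r), ⟨le_rfl, hr⟩, ⟨le_rfl, hr'⟩⟩
    let B : β → Set α := fun q => {p | p ∈ D ∧ q ≤ s p}
    have hlarge : IsLargeFamily κ (Set.range B) := by
      constructor
      · rintro _ ⟨q, rfl⟩ p hp p' hp' hne ⟨r, hr, hr'⟩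
        exact hX (hD p hp.1) (hD p' hp'.1) (fun he => hne (congrArg Prod.fst he))
          ⟨(r, q), ⟨hr, hp.2⟩, ⟨hr', hp'.2⟩⟩
      · refine hDc.trans (Cardinal.mk_le_mk_of_subset ?_)
        intro p hp
        exact ⟨_, ⟨s p, rfl⟩, hp, le_rfl⟩
    refine absurd (h _ hlarge) (not_lt.2 ((cellularity_le_iff' κ hκ).2 ?_))
    intro Y hY
    have hq : ∀ F : FinApprox (Set.range B), ∃ q, (↑F.1 : Set α) ⊆ B q := by
      rintro ⟨F, _, ⟨q, rfl⟩, hF⟩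
      exact ⟨q, hF⟩
    choose t ht using hq
    have key : ∀ F G : FinApprox (Set.range B), PCompat (t F) (t G) → PCompat F G := by
      classical
      rintro F G ⟨r, hr, hr'⟩
      refine ⟨⟨F.1 ∪ G.1, B r, ⟨r, rfl⟩, ?_⟩, Finset.subset_union_left, Finset.subset_union_right⟩
      rw [Finset.coe_union]
      exact Set.union_subset (fun p hp => ⟨(ht F hp).1, hr.trans (ht F hp).2⟩)
        (fun p hp => ⟨(ht G hp).1, hr'.trans (ht G hp).2⟩)
    have hinj : Set.InjOn t Y := by
      intro F hF G hG he
      by_contra hne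
      exact hY hF hG hne (key F G ⟨t F, le_rfl, he.le⟩)
    rw [← Cardinal.mk_image_eq_of_injOn t Y hinj]
    refine hβ _ ?_
    rintro _ ⟨F, hF, rfl⟩ _ ⟨G, hG, rfl⟩ hne hc
    exact hY hF hG (fun he => hne (congrArg t he)) (key F G hc)
end

section
/- A preorder ℙ is productively ccc if and only if ℱ(𝒜) is not ccc for every ℵ₀-large family 𝒜 of antichains of ℙ. -/
universe u

theorem cellularity_eq_iff {β : Type u} [Preorder β] :
    cellularity β = Cardinal.aleph0 ↔ ∀ A : Set β, PAntichain A → A.Countable := by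
  unfold cellularity
  rw [max_eq_left_iff]
  constructor
  · intro h A hA
    rw [← Cardinal.le_aleph0_iff_set_countable]
    refine le_trans (le_csSup (a := Cardinal.mk A) ?_ ?_) h
    swap
    · exact ⟨A, hA, rfl⟩
    refine ⟨Cardinal.mk β, ?_⟩
    rintro c ⟨B, -, rfl⟩
    exact Cardinal.mk_set_le B
  · intro h
    apply csSup_le'
    rintro c ⟨A, hA, rfl⟩
    exact Cardinal.le_aleph0_iff_set_countable.2 (h A hA)

/-- A preorder is productively ccc iff ℱ(𝒜) is not ccc for every ℵ₀-large family 𝒜. -/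
theorem productively_ccc_iff {α : Type u} [Preorder α] :
    (∀ (β : Type u) [Preorder β], cellularity β = Cardinal.aleph0 →
        cellularity (α × β) = Cardinal.aleph0) ↔
      ∀ 𝒜 : Set (Set α), IsLargeFamily Cardinal.aleph0 𝒜 →
        cellularity (FinApprox 𝒜) ≠ Cardinal.aleph0 := by
  constructor
  · intro h 𝒜 hA hc
    have h2 := cellularity_eq_iff.1 (h (FinApprox 𝒜) hc)
    obtain ⟨hA1, hA2⟩ := hA
    rw [Order.succ_le_iff] at hA2
    apply hA2.not_ge
    rw [Cardinal.le_aleph0_iff_set_countable]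
    have h3 := h2 {x | x.1 ∈ ⋃₀ 𝒜 ∧ x.2.1 = {x.1}} (by
      rintro ⟨p, F⟩ ⟨hp, hF⟩ ⟨q, G⟩ ⟨hq, hG⟩ hne ⟨⟨r, H⟩, ⟨hr1, hH1⟩, ⟨hr2, hH2⟩⟩
      simp only at hF hG hr1 hr2
      have e1 : F.1 ⊆ H.1 := hH1
      have e2 : G.1 ⊆ H.1 := hH2
      obtain ⟨A, hA, hHA⟩ := H.2
      have hpA : p ∈ A := hHA (e1 (by rw [hF]; simp))
      have hqA : q ∈ A := hHA (e2 (by rw [hG]; simp))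
      refine hA1 A hA hpA hqA ?_ ⟨r, hr1, hr2⟩
      rintro rfl
      exact hne (Prod.ext rfl (Subtype.ext (hF.trans hG.symm))))
    refine (h3.image Prod.fst).mono ?_
    intro p hp
    obtain ⟨A, hA, hpA⟩ := id hp
    exact ⟨(p, ⟨{p}, A, hA, by simpa using hpA⟩), ⟨hp, rfl⟩, rfl⟩
  · intro h β _ hβ
    rw [cellularity_eq_iff]
    intro W hW
    have hβ' := cellularity_eq_iff.1 hβ
    by_contra hWc
    have hS : ¬ (Prod.fst '' W).Countable := by
      intro hS
      apply hWc
      have hfib : ∀ p ∈ Prod.fst '' W, {w ∈ W | w.1 = p}.Countable := by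
        intro p _
        have : {q | (p, q) ∈ W}.Countable := by
          apply hβ'
          rintro q hq q' hq' hne ⟨r, h1, h2⟩
          exact hW hq hq' (fun e => hne (congrArg Prod.snd e))
            ⟨(p, r), ⟨le_rfl, h1⟩, ⟨le_rfl, h2⟩⟩
        refine (this.image (fun q => (p, q))).mono ?_
        rintro ⟨a, b⟩ ⟨hw, rfl⟩
        exact ⟨b, hw, rfl⟩
      refine (hS.biUnion hfib).mono ?_
      intro w hw
      simp only [Set.mem_iUnion]
      exact ⟨w.1, ⟨w, hw, rfl⟩, hw, rfl⟩
    have hex : ∀ p : α, ∃ w : α × β, p ∈ Prod.fst '' W → w ∈ W ∧ w.1 = p := by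
      intro p
      by_cases hp : p ∈ Prod.fst '' W
      · obtain ⟨w, hw⟩ := hp
        exact ⟨w, fun _ => hw⟩
      · have : W.Nonempty := by
          by_contra hn
          rw [Set.not_nonempty_iff_eq_empty] at hn
          exact hWc (by simp [hn])
        exact ⟨this.some, fun h => absurd h hp⟩
    choose w hw using hex
    set S := Prod.fst '' W with hSdef
    let 𝒜 : Set (Set α) := {a | a ⊆ S ∧ ∃ r : β, ∀ p ∈ a, r ≤ (w p).2}
    refine h 𝒜 ⟨?_, ?_⟩ ?_
    · rintro a ⟨haS, r, hr⟩ p hp q hq hne ⟨s, hs1, hs2⟩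
      obtain ⟨hp1, hp2⟩ := hw p (haS hp)
      obtain ⟨hq1, hq2⟩ := hw q (haS hq)
      refine hW hp1 hq1 (fun e => hne (by rw [← hp2, ← hq2, e])) ⟨(s, r), ⟨?_, hr p hp⟩, ⟨?_, hr q hq⟩⟩
      · rw [hp2]; exact hs1
      · rw [hq2]; exact hs2
    · rw [Order.succ_le_iff]
      by_contra hle
      rw [not_lt, Cardinal.le_aleph0_iff_set_countable] at hle
      refine hS (hle.mono ?_)
      intro p hp
      exact ⟨{p}, ⟨by simpa using hp, (w p).2, by simp⟩, rfl⟩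
    · rw [cellularity_eq_iff]
      intro X hX
      have hr : ∀ F : FinApprox 𝒜, ∃ r : β, ∀ p ∈ F.1, r ≤ (w p).2 := by
        intro F
        obtain ⟨a, ⟨_, r, hr⟩, hFa⟩ := F.2
        exact ⟨r, fun p hp => hr p (hFa hp)⟩
      have hFS : ∀ F : FinApprox 𝒜, (F.1 : Set α) ⊆ S := by
        intro F
        obtain ⟨a, ⟨ha, _⟩, hFa⟩ := F.2
        exact hFa.trans ha
      choose r hr using hr
      have key : ∀ F G : FinApprox 𝒜, PCompat (r F) (r G) → PCompat F G := by
        classical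
        rintro F G ⟨s, hs1, hs2⟩
        refine ⟨⟨F.1 ∪ G.1, (F.1 ∪ G.1 : Finset α), ⟨?_, s, ?_⟩, subset_rfl⟩, ?_, ?_⟩
        · rw [Finset.coe_union]
          exact Set.union_subset (hFS F) (hFS G)
        · intro p hp
          rcases Finset.mem_union.1 (Finset.mem_coe.1 hp) with hp | hp
          · exact hs1.trans (hr F p hp)
          · exact hs2.trans (hr G p hp)
        · exact Finset.subset_union_left
        · exact Finset.subset_union_right
      have hinj : Set.InjOn r X := by
        intro F hF G hG e
        by_contra hne
        exact hX hF hG hne (key F G ⟨r F, le_rfl, e.le⟩)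
      refine Set.countable_of_injective_of_countable_image hinj (hβ' _ ?_)
      rintro _ ⟨F, hF, rfl⟩ _ ⟨G, hG, rfl⟩ hne hc
      exact hX hF hG (fun e => hne (by rw [e])) (key F G hc)
end

section
/- For every preorder ℙ, the density d(ℙ) belongs to spec(ℙ). -/
universe u

/-- A subset D of a preorder is *dense* if below every element there is an element of D. -/
def PDense {α : Type u} [Preorder α] (D : Set α) : Prop := ∀ p : α, ∃ d ∈ D, d ≤ p

/-- The *density* of a preorder: the least infinite cardinal of the form |D| for D dense. -/
noncomputable def pDensity (α : Type u) [Preorder α] : Cardinal.{u} :=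
  max Cardinal.aleph0
    (sInf {c : Cardinal.{u} | ∃ D : Set α, PDense D ∧ c = Cardinal.mk ↑D})

/-- The density of a preorder belongs to its cellular spectrum. -/
theorem density_mem_cellSpec {α : Type u} [Preorder α] : pDensity α ∈ cellSpec α := by
  refine ⟨le_max_left _ _, ?_⟩
  intro β _ hβ
  obtain ⟨D, hD, hDc⟩ : sInf {c : Cardinal.{u} | ∃ D : Set α, PDense D ∧ c = Cardinal.mk ↑D} ∈
      {c : Cardinal.{u} | ∃ D : Set α, PDense D ∧ c = Cardinal.mk ↑D} :=
    csInf_mem ⟨_, Set.univ, fun p => ⟨p, trivial, le_rfl⟩, rfl⟩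
  have hDk : Cardinal.mk ↑D ≤ pDensity α := hDc ▸ le_max_right _ _
  have h0 : Cardinal.aleph0 ≤ pDensity α := le_max_left _ _
  have hB : ∀ B : Set β, PAntichain B → Cardinal.mk ↑B ≤ pDensity α := by
    intro B hB
    refine le_trans (le_trans ?_ (le_max_right _ _)) hβ
    refine le_csSup ⟨Cardinal.mk β, ?_⟩ ⟨B, hB, rfl⟩
    rintro c ⟨A, -, rfl⟩
    exact Cardinal.mk_set_le A
  refine max_le h0 (csSup_le' ?_)
  rintro c ⟨A, hA, rfl⟩
  choose g hgD hg using hD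
  let f : A → D := fun a => ⟨g a.1.1, hgD _⟩
  have key : ∀ a b : A, f a = f b → PCompat a.1.2 b.1.2 → a = b := by
    intro a b hab ⟨r, hra, hrb⟩
    by_contra hne
    have hab' : g a.1.1 = g b.1.1 := congrArg Subtype.val hab
    exact hA a.2 b.2 (fun h => hne (Subtype.ext h))
      ⟨(g a.1.1, r), ⟨hg _, hra⟩, ⟨hab' ▸ hg b.1.1, hrb⟩⟩
  have hf : ∀ d : D, Cardinal.mk ↑(f ⁻¹' {d}) ≤ pDensity α := by
    intro d
    have hinj : Set.InjOn (fun a : A => a.1.2) (f ⁻¹' {d}) := by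
      intro a ha b hb hab
      exact key a b (Eq.trans ha (Eq.symm hb)) ⟨a.1.2, le_rfl, le_of_eq hab⟩
    rw [← Cardinal.mk_image_eq_of_injOn _ _ hinj]
    apply hB
    rintro _ ⟨a, ha, rfl⟩ _ ⟨b, hb, rfl⟩ hne hc
    exact hne (congrArg (fun a : A => a.1.2) (key a b (Eq.trans ha (Eq.symm hb)) hc))
  calc Cardinal.mk ↑A ≤ Cardinal.mk ↑D * pDensity α :=
        Cardinal.mk_le_mk_mul_of_mk_preimage_le f hf
    _ ≤ pDensity α * pDensity α := mul_le_mul_left hDk _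
    _ = pDensity α := Cardinal.mul_eq_self h0
end

section
/- If ℙ is a preorder and κ is an infinite cardinal with κ ≥ d(ℙ), then κ ∈ spec(ℙ). -/
universe u

/-- Every infinite cardinal at least the density belongs to the cellular spectrum. -/
theorem mem_cellSpec_of_density_le {α : Type u} [Preorder α] (κ : Cardinal.{u})
    (hκ : Cardinal.aleph0 ≤ κ) (h : pDensity α ≤ κ) : κ ∈ cellSpec α := by
  obtain ⟨D, hD, hDc⟩ : ∃ D : Set α, PDense D ∧ Cardinal.mk ↑D ≤ κ := by
    have hne : {c : Cardinal.{u} | ∃ D : Set α, PDense D ∧ c = Cardinal.mk ↑D}.Nonempty :=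
      ⟨_, Set.univ, fun p => ⟨p, trivial, le_refl p⟩, rfl⟩
    obtain ⟨D, hD, hDc⟩ := csInf_mem hne
    exact ⟨D, hD, hDc ▸ (le_max_right _ _).trans h⟩
  refine ⟨hκ, fun β _ hβ => max_le hκ (csSup_le' ?_)⟩
  rintro _ ⟨A, hA, rfl⟩
  have hβ' : ∀ B : Set β, PAntichain B → Cardinal.mk ↑B ≤ κ := by
    intro B hB
    refine le_trans ?_ ((le_max_right _ _).trans hβ)
    refine le_csSup ?_ ⟨B, hB, rfl⟩
    refine ⟨Cardinal.mk β, ?_⟩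
    rintro _ ⟨C, _, rfl⟩
    exact Cardinal.mk_set_le C
  choose g hgD hg using hD
  let f : A → D := fun a => ⟨g a.1.1, hgD _⟩
  have key : ∀ d : D, ∀ a b : {a : A // f a = d}, PCompat a.1.1.2 b.1.1.2 → a = b := by
    rintro d ⟨⟨a, ha⟩, had⟩ ⟨⟨b, hb⟩, hbd⟩ ⟨r, hr1, hr2⟩
    by_contra hne
    have hne' : a ≠ b := by
      rintro rfl
      exact hne rfl
    refine hA ha hb hne' ⟨(d.1, r), ⟨?_, hr1⟩, ⟨?_, hr2⟩⟩
    · rw [← had]; exact hg _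
    · rw [← hbd]; exact hg _
  have hfib : ∀ d : D, Cardinal.mk {a : A // f a = d} ≤ κ := by
    intro d
    let s : {a : A // f a = d} → β := fun a => a.1.1.2
    have hs : Function.Injective s := by
      intro a b hab
      exact key d a b ⟨s a, le_refl _, le_of_eq hab⟩
    rw [← Cardinal.mk_range_eq s hs]
    apply hβ'
    rintro _ ⟨a, rfl⟩ _ ⟨b, rfl⟩ hne hc
    exact hne (congrArg s (key d a b hc))
  calc Cardinal.mk A = Cardinal.mk (Σ d : D, {a : A // f a = d}) :=
        (Cardinal.mk_congr (Equiv.sigmaFiberEquiv f)).symm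
    _ = Cardinal.sum fun d : D => Cardinal.mk {a : A // f a = d} := Cardinal.mk_sigma _
    _ ≤ Cardinal.sum fun _ : D => κ := Cardinal.sum_le_sum _ _ hfib
    _ = Cardinal.mk D * κ := Cardinal.sum_const' _ _
    _ ≤ κ * κ := by gcongr
    _ = κ := Cardinal.mul_eq_self hκ
end

section
/- For a nonempty family {ℙᵢ : i ∈ I} of forcing posets (preorders each having a largest element), one has spec(∏^fin_{i∈I} ℙᵢ) = ⋂_{i∈I} spec(ℙᵢ), where ∏^fin denotes the finite support product. -/
universe u

/-- The *finite support product* of forcing posets: tuples equal to the largest element in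
all but finitely many coordinates, with the coordinatewise preorder. -/
abbrev FinSupport {I : Type u} (P : I → Type u) [∀ i, Preorder (P i)]
    [∀ i, OrderTop (P i)] : Type u :=
  {f : ∀ i, P i // {i | f i ≠ ⊤}.Finite}

open Cardinal in
theorem cellularity_le_iff {α : Type u} [Preorder α] {κ : Cardinal.{u}} :
    cellularity α ≤ κ ↔ ℵ₀ ≤ κ ∧ ∀ (ι : Type u) (f : ι → α),
      (∀ x y, x ≠ y → ¬ PCompat (f x) (f y)) → #ι ≤ κ := by
  have hb : BddAbove {c : Cardinal.{u} | ∃ A : Set α, PAntichain A ∧ c = #A} := by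
    refine ⟨#α, ?_⟩
    rintro c ⟨A, -, rfl⟩
    exact Cardinal.mk_set_le A
  unfold cellularity
  rw [max_le_iff]
  refine and_congr_right fun hκ => ⟨fun h ι f hf => ?_, fun h => ?_⟩
  · have hinj : Function.Injective f := by
      intro x y hxy
      by_contra hne
      exact hf x y hne ⟨f x, le_rfl, hxy.le⟩
    rw [← Cardinal.mk_range_eq f hinj]
    refine le_trans (le_csSup hb ⟨Set.range f, ?_, rfl⟩) h
    rintro _ ⟨x, rfl⟩ _ ⟨y, rfl⟩ hne
    exact hf x y (fun e => hne (congrArg f e))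
  · refine csSup_le' ?_
    rintro c ⟨A, hA, rfl⟩
    exact h A (fun a => a.1) (fun x y hxy => hA x.2 y.2 (fun e => hxy (Subtype.ext e)))

/-- The support of an element of the finite support product. -/
def fsupp {I : Type u} {P : I → Type u} [∀ i, Preorder (P i)]
    [∀ i, OrderTop (P i)] (f : FinSupport P) : Set I := {i | f.1 i ≠ ⊤}

open Classical in
/-- Reset one coordinate. -/
noncomputable def fupd {I : Type u} {P : I → Type u} [∀ i, Preorder (P i)]
    [∀ i, OrderTop (P i)] (f : FinSupport P) (i : I) (p : P i) : FinSupport P :=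
  ⟨Function.update f.1 i p, (f.2.insert i).subset (by
    intro j hj
    by_cases h : j = i
    · exact Or.inl h
    · right
      simpa [Function.update_of_ne h] using hj)⟩

open Classical in
theorem compat_of_disjoint {I : Type u} {P : I → Type u} [∀ i, Preorder (P i)]
    [∀ i, OrderTop (P i)] (f g : FinSupport P) (h : Disjoint (fsupp f) (fsupp g)) :
    PCompat f g := by
  refine ⟨⟨fun i => if f.1 i = ⊤ then g.1 i else f.1 i, (f.2.union g.2).subset ?_⟩, ?_, ?_⟩
  · intro i hi
    by_cases h1 : f.1 i = ⊤
    · right; simpa [h1] using hi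
    · left; exact h1
  · intro i
    by_cases h1 : f.1 i = ⊤
    · simp [h1]
    · simp [h1]
  · intro i
    by_cases h1 : f.1 i = ⊤
    · simp [h1]
    · have h2 : g.1 i = ⊤ := by
        by_contra h2
        exact Set.disjoint_left.1 h h1 h2
      simp [h2]

theorem PCompat.prod {α β : Type u} [Preorder α] [Preorder β] {a a' : α} {b b' : β}
    (h : PCompat a a') (h' : PCompat b b') : PCompat (a, b) (a', b') := by
  obtain ⟨r, h1, h2⟩ := h
  obtain ⟨s, h3, h4⟩ := h'
  exact ⟨(r, s), ⟨h1, h3⟩, ⟨h2, h4⟩⟩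

theorem compat_of_fupd {I : Type u} {P : I → Type u} [∀ i, Preorder (P i)]
    [∀ i, OrderTop (P i)] {f g : FinSupport P} {i : I} (h : PCompat (f.1 i) (g.1 i))
    (h' : PCompat (fupd f i ⊤) (fupd g i ⊤)) : PCompat f g := by
  classical
  obtain ⟨r, h1, h2⟩ := h
  obtain ⟨s, h3, h4⟩ := h'
  refine ⟨fupd s i r, ?_, ?_⟩
  · intro j
    by_cases hj : j = i
    · subst hj; simpa [fupd] using h1
    · have := h3 j
      simpa [fupd, Function.update_of_ne hj] using this
  · intro j
    by_cases hj : j = i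
    · subst hj; simpa [fupd] using h2
    · have := h4 j
      simpa [fupd, Function.update_of_ne hj] using this

theorem fsupp_fupd {I : Type u} {P : I → Type u} [∀ i, Preorder (P i)]
    [∀ i, OrderTop (P i)] (f : FinSupport P) (i : I) :
    fsupp (fupd f i ⊤) = fsupp f \ {i} := by
  classical
  ext j
  by_cases hj : j = i
  · subst hj; simp [fsupp, fupd]
  · simp [fsupp, fupd, Function.update_of_ne hj, hj]

open Cardinal in
theorem main_bound {I : Type u} (P : I → Type u) [∀ i, Preorder (P i)]
    [∀ i, OrderTop (P i)] {κ : Cardinal.{u}} (hκ : ℵ₀ ≤ κ) (hP : ∀ i, κ ∈ cellSpec (P i))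
    (n : ℕ) : ∀ (β : Type u) [Preorder β], cellularity β ≤ κ →
      ∀ (ι : Type u) (f : ι → FinSupport P) (g : ι → β),
      (∀ x, (fsupp (f x)).ncard ≤ n) →
      (∀ x y, x ≠ y → ¬ PCompat (f x, g x) (f y, g y)) → #ι ≤ κ := by
  induction n with
  | zero =>
    intro β _ hβ ι f g hn hfg
    refine (cellularity_le_iff.1 hβ).2 ι g fun x y hxy hc => hfg x y hxy ?_
    refine PCompat.prod (compat_of_disjoint _ _ ?_) hc
    have : fsupp (f x) = ∅ := (Set.ncard_eq_zero (f x).2).1 (Nat.le_zero.1 (hn x))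
    simp [this]
  | succ n ih =>
    intro β _ hβ ι f g hn hfg
    obtain ⟨M, hM⟩ := zorn_subset
      {M : Set ι | M.Pairwise fun x y => Disjoint (fsupp (f x)) (fsupp (f y))} (by
        intro c hc hchain
        refine ⟨⋃₀ c, ?_, fun s hs => Set.subset_sUnion_of_mem hs⟩
        exact (Set.pairwise_sUnion hchain.directedOn).2 hc)
    have hMκ : #M ≤ κ := by
      refine (cellularity_le_iff.1 hβ).2 M (fun x => g x.1) fun x y hxy hc => ?_
      have hne : x.1 ≠ y.1 := fun e => hxy (Subtype.ext e)
      exact hfg x.1 y.1 hne (PCompat.prod (compat_of_disjoint _ _ (hM.prop x.2 y.2 hne)) hc)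
    have hUκ : #(⋃ y : M, fsupp (f y.1) : Set I) ≤ κ := by
      refine (Cardinal.mk_iUnion_le _).trans ?_
      refine (mul_le_mul' hMκ (ciSup_le' (a := κ) fun y => ?_)).trans (Cardinal.mul_eq_self hκ).le
      exact ((Cardinal.lt_aleph0_iff_set_finite.2 (f y.1).2).le).trans hκ
    have hA : ∀ i : I, #{x : ι | i ∈ fsupp (f x)} ≤ κ := by
      intro i
      refine ih (P i × β) ((hP i).2 β hβ) _ (fun x => fupd (f x.1) i ⊤)
        (fun x => ((f x.1).1 i, g x.1)) ?_ ?_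
      · intro x
        rw [fsupp_fupd]
        have hi : i ∈ fsupp (f x.1) := x.2
        have hfin : (fsupp (f x.1)).Finite := (f x.1).2
        have h1 := Set.ncard_sdiff_singleton_add_one hi hfin
        have h2 := hn x.1
        omega
      · intro x y hxy hc
        refine hfg x.1 y.1 (fun e => hxy (Subtype.ext e)) ?_
        obtain ⟨⟨r, s, t⟩, ⟨h1, h2, h3⟩, ⟨h4, h5, h6⟩⟩ := hc
        exact PCompat.prod (compat_of_fupd ⟨s, h2, h5⟩ ⟨r, h1, h4⟩) ⟨t, h3, h6⟩
    have hcover : (Set.univ : Set ι) ⊆ M ∪ ⋃ i : (⋃ y : M, fsupp (f y.1) : Set I),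
        {x : ι | i.1 ∈ fsupp (f x)} := by
      intro x _
      by_cases hx : x ∈ M
      · exact Or.inl hx
      right
      by_contra hcon
      refine hx (hM.le_of_ge (y := insert x M) ?_ (Set.subset_insert x M) (Set.mem_insert x M))
      have key : ∀ y ∈ M, Disjoint (fsupp (f x)) (fsupp (f y)) := by
        intro y hy
        refine Set.disjoint_left.2 fun i hi hi' => hcon ?_
        exact Set.mem_iUnion.2 ⟨⟨i, Set.mem_iUnion.2 ⟨⟨y, hy⟩, hi'⟩⟩, hi⟩
      exact Set.Pairwise.insert hM.prop fun y hy _ => ⟨key y hy, (key y hy).symm⟩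
    rw [← Cardinal.mk_univ]
    refine (Cardinal.mk_le_mk_of_subset hcover).trans ((Cardinal.mk_union_le _ _).trans ?_)
    refine (add_le_add hMκ ?_).trans (Cardinal.add_eq_self hκ).le
    refine (Cardinal.mk_iUnion_le _).trans ?_
    refine le_trans (mul_le_mul' hUκ (ciSup_le' (a := κ) ?_)) (Cardinal.mul_eq_self hκ).le
    intro i
    exact hA i.1

/-- The cellular spectrum of a finite support product of forcing posets is the
intersection of the spectra. -/
theorem cellSpec_finSupport {I : Type u} [Nonempty I] (P : I → Type u)
    [∀ i, Preorder (P i)] [∀ i, OrderTop (P i)] :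
    cellSpec (FinSupport P) = ⋂ i, cellSpec (P i) := by
  classical
  ext κ
  rw [Set.mem_iInter]
  constructor
  · rintro ⟨hκ, h⟩ i
    refine ⟨hκ, fun β _ hβ => cellularity_le_iff.2 ⟨hκ, fun ι f hf => ?_⟩⟩
    let T : FinSupport P := ⟨fun _ => ⊤, by simp⟩
    refine (cellularity_le_iff.1 (h β hβ)).2 ι (fun x => (fupd T i (f x).1, (f x).2))
      fun x y hxy hc => hf x y hxy ?_
    obtain ⟨⟨r, s⟩, ⟨h1, h2⟩, ⟨h3, h4⟩⟩ := hc
    refine ⟨(r.1 i, s), ⟨?_, h2⟩, ⟨?_, h4⟩⟩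
    · have := h1 i
      simpa [fupd] using this
    · have := h3 i
      simpa [fupd] using this
  · intro h
    have hκ : Cardinal.aleph0 ≤ κ := (h (Classical.arbitrary I)).1
    refine ⟨hκ, fun β _ hβ => cellularity_le_iff.2 ⟨hκ, fun ι f hf => ?_⟩⟩
    have hA : ∀ n : ULift.{u} ℕ, Cardinal.mk {x : ι | (fsupp (f x).1).ncard ≤ n.down} ≤ κ := by
      intro n
      exact main_bound P hκ h n.down β hβ _ (fun x => (f x.1).1) (fun x => (f x.1).2)
        (fun x => x.2) (fun x y hxy => hf x.1 y.1 (fun e => hxy (Subtype.ext e)))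
    have hcover : (Set.univ : Set ι) ⊆ ⋃ n : ULift.{u} ℕ,
        {x : ι | (fsupp (f x).1).ncard ≤ n.down} := fun x _ =>
      Set.mem_iUnion.2 ⟨⟨_⟩, le_refl (fsupp (f x).1).ncard⟩
    rw [← Cardinal.mk_univ]
    refine (Cardinal.mk_le_mk_of_subset hcover).trans ((Cardinal.mk_iUnion_le _).trans ?_)
    refine (mul_le_mul' ?_ (ciSup_le' hA)).trans (Cardinal.mul_eq_self hκ).le
    simpa using hκ
end

section
/- If {ℙᵢ : i ∈ I} is a nonempty family of forcing posets, then sup_{i∈I} d(ℙᵢ) belongs to spec(∏^fin_{i∈I} ℙᵢ). -/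
universe u

theorem aux_card_le {τ ι : Type u} {κ : Cardinal.{u}} (hκ : Cardinal.aleph0 ≤ κ) (T : Set τ)
    (J : Set ι) (U : ι → Set τ) (hJ : Cardinal.mk J ≤ κ)
    (hU : ∀ j ∈ J, Cardinal.mk (U j) ≤ κ) (hT : T ⊆ ⋃ j ∈ J, U j) : Cardinal.mk T ≤ κ := by
  refine (Cardinal.mk_le_mk_of_subset hT).trans ?_
  rw [Set.biUnion_eq_iUnion]
  refine (Cardinal.mk_iUnion_le _).trans ?_
  refine (mul_le_mul' hJ (ciSup_le' fun j : J => hU j.1 j.2)).trans ?_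
  rw [Cardinal.mul_eq_self hκ]

theorem aux_delta {τ I : Type u} {P : I → Type u} {κ : Cardinal.{u}}
    (hκ : Cardinal.aleph0 ≤ κ) (D : ∀ i, Set (P i)) (hD : ∀ i, Cardinal.mk (D i) ≤ κ)
    (g : τ → ∀ i, P i) (hg : ∀ t i, g t i ∈ D i) (n : ℕ) :
    ∀ (s : τ → Finset I) (T : Set τ), (∀ t ∈ T, (s t).card ≤ n) → κ < Cardinal.mk T →
    ∃ S ⊆ T, κ < Cardinal.mk S ∧
      S.Pairwise (fun a b => ∀ i, i ∈ s a → i ∈ s b → g a i = g b i) := by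
  classical
  induction n with
  | zero =>
    intro s T h hT
    refine ⟨T, subset_rfl, hT, fun a ha b _ _ i hi => ?_⟩
    have := h a ha
    simp only [Nat.le_zero, Finset.card_eq_zero] at this
    simp [this] at hi
  | succ n ih =>
    intro s T h hT
    by_cases hc : ∃ i, ∃ d : P i, κ < Cardinal.mk {t | t ∈ T ∧ i ∈ s t ∧ g t i = d}
    · obtain ⟨i, d, hc⟩ := hc
      obtain ⟨S, hST, hS, hp⟩ := ih (fun t => (s t).erase i) _ (by
        rintro t ⟨ht, hi, -⟩
        have := h t ht
        rw [Finset.card_erase_of_mem hi]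
        omega) hc
      refine ⟨S, fun t ht => (hST ht).1, hS, fun a ha b hb hab j hja hjb => ?_⟩
      by_cases hj : j = i
      · subst hj
        rw [(hST ha).2.2, (hST hb).2.2]
      · exact hp ha hb hab j (Finset.mem_erase.2 ⟨hj, hja⟩) (Finset.mem_erase.2 ⟨hj, hjb⟩)
    · push Not at hc
      have hi : ∀ i, Cardinal.mk {t | t ∈ T ∧ i ∈ s t} ≤ κ := fun i => by
        refine aux_card_le hκ _ (D i) (fun d => {t | t ∈ T ∧ i ∈ s t ∧ g t i = d}) (hD i)
          (fun d _ => hc i d) ?_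
        rintro t ⟨ht, hts⟩
        simp only [Set.mem_iUnion]
        exact ⟨g t i, hg t i, ht, hts, rfl⟩
      obtain ⟨S, hS⟩ := zorn_subset
        {S : Set τ | S ⊆ T ∧ S.Pairwise (fun a b => Disjoint (s a) (s b))} (by
          intro c hc hch
          refine ⟨⋃₀ c, ⟨Set.sUnion_subset fun x hx => (hc hx).1, ?_⟩,
            fun x hx => Set.subset_sUnion_of_mem hx⟩
          exact (Set.pairwise_sUnion hch.directedOn).2 fun x hx => (hc hx).2)
      refine ⟨S, hS.prop.1, ?_, fun a ha b hb hab i hia hib =>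
        absurd hib (Finset.disjoint_left.1 (hS.prop.2 ha hb hab) hia)⟩
      by_contra hlt
      push Not at hlt
      refine absurd hT (not_lt.2 ?_)
      have hR : Cardinal.mk (⋃ a ∈ S, (↑(s a) : Set I) : Set I) ≤ κ :=
        aux_card_le hκ _ S (fun a => (↑(s a) : Set I)) hlt
          (fun a _ => (Cardinal.lt_aleph0_of_finite _).le.trans hκ) subset_rfl
      have hU := aux_card_le hκ _ _ (fun i => {t | t ∈ T ∧ i ∈ s t}) hR (fun i _ => hi i)
        subset_rfl
      refine (Cardinal.mk_le_mk_of_subset (t := S ∪ _) ?_).trans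
        ((Cardinal.mk_union_le S _).trans ((add_le_add hlt hU).trans
          (Cardinal.add_eq_self hκ).le))
      intro t ht
      by_contra hn
      simp only [Set.mem_union, Set.mem_iUnion, not_or, not_exists] at hn
      refine hn.1 (hS.le_of_ge (y := insert t S) ⟨Set.insert_subset ht hS.prop.1, ?_⟩
        (Set.subset_insert _ _) (Set.mem_insert _ _))
      have hd : ∀ b ∈ S, Disjoint (s t) (s b) := fun b hb =>
        Finset.disjoint_left.2 fun i hit hib => hn.2 i ⟨b, hb, hib⟩ ⟨ht, hit⟩
      exact hS.prop.2.insert fun b hb _ => ⟨hd b hb, (hd b hb).symm⟩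

theorem aux_cell_le {α : Type u} [Preorder α] (A : Set α) (hA : PAntichain A) :
    Cardinal.mk A ≤ cellularity α := by
  refine le_trans ?_ (le_max_right _ _)
  refine le_csSup ⟨Cardinal.mk α, ?_⟩ ⟨A, hA, rfl⟩
  rintro c ⟨B, -, rfl⟩
  exact Cardinal.mk_set_le B

theorem aux_dense (α : Type u) [Preorder α] :
    ∃ D : Set α, PDense D ∧ Cardinal.mk D ≤ pDensity α := by
  obtain ⟨D, hD, h⟩ := csInf_mem
    (s := {c : Cardinal.{u} | ∃ D : Set α, PDense D ∧ c = Cardinal.mk ↑D})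
    ⟨_, Set.univ, fun p => ⟨p, trivial, le_rfl⟩, rfl⟩
  exact ⟨D, hD, h ▸ le_max_right _ _⟩

/-- The supremum of the densities belongs to the spectrum of the finite support product. -/
theorem sup_density_mem_cellSpec_finSupport {I : Type u} [Nonempty I] (P : I → Type u)
    [∀ i, Preorder (P i)] [∀ i, OrderTop (P i)] :
    (⨆ i, pDensity (P i)) ∈ cellSpec (FinSupport P) := by
  classical
  have hle : ∀ i, pDensity (P i) ≤ ⨆ i, pDensity (P i) :=
    fun i => le_ciSup Cardinal.bddAbove_of_small i
  generalize (⨆ i, pDensity (P i)) = κ at hle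
  have hκ : Cardinal.aleph0 ≤ κ :=
    (le_max_left _ _).trans (hle (Classical.arbitrary I))
  refine ⟨hκ, fun β _ hβ => max_le hκ (csSup_le' ?_)⟩
  rintro c ⟨A, hA, rfl⟩
  by_contra hlt
  push Not at hlt
  choose D hDd hD using fun i => aux_dense (P i)
  choose e heD hele using hDd
  let s : FinSupport P × β → Finset I := fun t => t.1.2.toFinset
  let g : FinSupport P × β → ∀ i, P i := fun t i => e i (t.1.1 i)
  have hn : ∃ n : ℕ, κ < Cardinal.mk {t | t ∈ A ∧ (s t).card ≤ n} := by
    by_contra hn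
    push Not at hn
    refine absurd hlt (not_lt.2 ?_)
    refine aux_card_le hκ A (Set.univ : Set (ULift.{u} ℕ))
      (fun n => {t | t ∈ A ∧ (s t).card ≤ n.down}) ?_ (fun n _ => hn n.down) ?_
    · simpa using hκ
    · intro t ht
      simp only [Set.mem_iUnion]
      exact ⟨⟨(s t).card⟩, trivial, ht, le_rfl⟩
  obtain ⟨n, hn⟩ := hn
  obtain ⟨S, hST, hS, hp⟩ := aux_delta hκ D (fun i => (hD i).trans (hle i)) g
    (fun t i => heD i _) n s _ (fun t ht => ht.2) hn
  have key : ∀ a ∈ S, ∀ b ∈ S, a ≠ b → ¬ PCompat a.2 b.2 := by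
    rintro a ha b hb hab ⟨r, hra, hrb⟩
    refine hA (hST ha).1 (hST hb).1 hab ?_
    have hs : ∀ (t : FinSupport P × β) i, i ∉ s t → t.1.1 i = ⊤ := fun t i hi => by
      simpa [s] using hi
    refine ⟨(⟨fun i => if i ∈ s a then g a i else if i ∈ s b then g b i else ⊤,
      ((s a ∪ s b).finite_toSet).subset ?_⟩, r), ⟨?_, hra⟩, ⟨?_, hrb⟩⟩
    · intro i hi
      by_contra hni
      simp only [Finset.coe_union, Set.mem_union, Finset.mem_coe, not_or] at hni
      simp [hni.1, hni.2] at hi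
    · intro i
      by_cases hia : i ∈ s a
      · simpa [hia] using hele i _
      · simp [hs a i hia]
    · intro i
      by_cases hib : i ∈ s b
      · by_cases hia : i ∈ s a
        · simpa [hia, hp ha hb hab i hia hib] using hele i _
        · simpa [hia, hib] using hele i _
      · simp [hs b i hib]
  have hinj : Set.InjOn (Prod.snd : FinSupport P × β → β) S := by
    intro a ha b hb h
    by_contra hab
    exact key a ha b hb hab ⟨a.2, le_rfl, h.le⟩
  have hanti : PAntichain (Prod.snd '' S) := by
    rintro _ ⟨a, ha, rfl⟩ _ ⟨b, hb, rfl⟩ hab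
    exact key a ha b hb fun h => hab (h ▸ rfl)
  have := (aux_cell_le _ hanti).trans hβ
  rw [Cardinal.mk_image_eq_of_injOn _ _ hinj] at this
  exact absurd hS (not_lt.2 this)
end
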